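/- (Corollary 1: for bandwidth compression the Tian et al. outer bound degenerates to the trivial outer bound.) Let K ≥ 1, P > 0, N_1 > N_2 > … > N_K > 0, and 0 < b < 1, and let D_1,…,D_K be positive reals. Then the inequality F(D,τ) ≤ P + N_1 holds for every choice of nonnegative reals 0 = τ_K ≤ τ_{K−1} ≤ … ≤ τ_1 if and only if D_k ≥ D_k* = (N_k/(P+N_k))^b for every k with 1 ≤ k ≤ K. -/

import Mathlib

open Finset

/-- `ΔN_k`: `N_k − N_{k+1}` for `1 ≤ k ≤ K−1`, and `ΔN_K = N_K`. -/
noncomputable def deltaN (K : ℕ) (N : ℕ → ℝ) (k : ℕ) : ℝ :=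
  if k = K then N K else N k - N (k + 1)

/-- The Tian et al. outer-bound expression
`F(D,τ) = ∑_{k=1}^K ΔN_k · [ (1+τ_k) · ∏_{j=2}^k (D_j+τ_{j−1}) / ∏_{j=1}^k (D_j+τ_j) ]^{1/b}`. -/
noncomputable def tianF (K : ℕ) (N : ℕ → ℝ) (b : ℝ) (D τ : ℕ → ℝ) : ℝ :=
  ∑ k ∈ Icc 1 K, deltaN K N k *
    ((1 + τ k) * (∏ j ∈ Icc 2 k, (D j + τ (j - 1))) /
      (∏ j ∈ Icc 1 k, (D j + τ j))) ^ (1 / b)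

/-- The base of the `k`-th power in `tianF`. -/
noncomputable def tianT (D τ : ℕ → ℝ) (k : ℕ) : ℝ :=
  (1 + τ k) * (∏ j ∈ Icc 2 k, (D j + τ (j - 1))) / (∏ j ∈ Icc 1 k, (D j + τ j))

theorem tianT_one (D τ : ℕ → ℝ) : tianT D τ 1 = (1 + τ 1) / (D 1 + τ 1) := by
  simp [tianT]

theorem tianT_succ (D τ : ℕ → ℝ) (k : ℕ) (hk : 1 ≤ k) (h0 : 1 + τ k ≠ 0) :
    tianT D τ (k + 1) = tianT D τ k *
      (((1 + τ (k + 1)) * (D (k + 1) + τ k)) / ((1 + τ k) * (D (k + 1) + τ (k + 1)))) := by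
  unfold tianT
  rw [Finset.prod_Icc_succ_top (by omega), Finset.prod_Icc_succ_top (by omega)]
  rw [div_mul_div_comm, Nat.add_sub_cancel]
  rw [← mul_div_mul_left _ _ h0]
  congr 1 <;> ring

theorem tianT_pos (K : ℕ) (D τ : ℕ → ℝ) (hD : ∀ k, 1 ≤ k → k ≤ K → 0 < D k)
    (hτ : ∀ k, 0 ≤ τ k) (k : ℕ) (hk : k ≤ K) : 0 < tianT D τ k := by
  unfold tianT
  have h1 : 0 < ∏ j ∈ Icc 2 k, (D j + τ (j - 1)) := by
    apply Finset.prod_pos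
    intro j hj
    rw [Finset.mem_Icc] at hj
    have := hD j (by omega) (by omega)
    have := hτ (j - 1)
    linarith
  have h2 : 0 < ∏ j ∈ Icc 1 k, (D j + τ j) := by
    apply Finset.prod_pos
    intro j hj
    rw [Finset.mem_Icc] at hj
    have := hD j (by omega) (by omega)
    have := hτ j
    linarith
  have := hτ k
  positivity

theorem superadd (b w v x y d A : ℝ) (hb0 : 0 < b) (hb1 : b < 1) (hw : 0 ≤ w) (hv : 0 ≤ v)
    (hwv : w + v = 1) (hx : 0 < x) (hy : 0 < y) (hd : 0 ≤ d) (hA : 0 < A)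
    (h : A ^ b = w * x ^ b + v * y ^ b) :
    (A + d) ^ b ≤ w * (x + d) ^ b + v * (y + d) ^ b := by
  have hAd : 0 < A + d := by linarith
  have key : ∀ z, 0 < z →
      (A / (A + d)) * (z ^ b / A ^ b) + d / (A + d) ≤ (z + d) ^ b / (A + d) ^ b := by
    intro z hz
    have hc := (Real.concaveOn_rpow hb0.le hb1.le).2
      (show z / A ∈ Set.Ici (0 : ℝ) by simp only [Set.mem_Ici]; positivity)
      (show (1 : ℝ) ∈ Set.Ici (0 : ℝ) by simp)
      (show 0 ≤ A / (A + d) by positivity) (show 0 ≤ d / (A + d) by positivity) (by field_simp)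
    simp only [smul_eq_mul, Real.one_rpow, mul_one] at hc
    rw [← Real.div_rpow hz.le hA.le, ← Real.div_rpow (by linarith) hAd.le]
    have e : A / (A + d) * (z / A) + d / (A + d) = (z + d) / (A + d) := by
      field_simp
    rw [e] at hc
    exact hc
  have kx := mul_le_mul_of_nonneg_left (key x hx) hw
  have ky := mul_le_mul_of_nonneg_left (key y hy) hv
  have hAb : 0 < A ^ b := Real.rpow_pos_of_pos hA b
  have hAdb : 0 < (A + d) ^ b := Real.rpow_pos_of_pos hAd b
  have e1 : w * (A / (A + d) * (x ^ b / A ^ b) + d / (A + d)) +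
      v * (A / (A + d) * (y ^ b / A ^ b) + d / (A + d)) = 1 := by
    have : w * (A / (A + d) * (x ^ b / A ^ b) + d / (A + d)) +
      v * (A / (A + d) * (y ^ b / A ^ b) + d / (A + d)) =
      A / (A + d) * ((w * x ^ b + v * y ^ b) / A ^ b) + (w + v) * (d / (A + d)) := by ring
    rw [this, ← h, hwv, div_self hAb.ne']
    field_simp
  have e2 : w * ((x + d) ^ b / (A + d) ^ b) + v * ((y + d) ^ b / (A + d) ^ b) =
      (w * (x + d) ^ b + v * (y + d) ^ b) / (A + d) ^ b := by ring
  have : 1 ≤ (w * (x + d) ^ b + v * (y + d) ^ b) / (A + d) ^ b := by linarith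
  rwa [le_div_iff₀ hAdb, one_mul] at this

theorem mean_pow (P b n t : ℝ) (hP : 0 < P) (hb0 : 0 < b) (hn : 0 < n) (ht : 0 ≤ t) :
    ((P + n) * (((n / (P + n)) ^ b + t) / (1 + t)) ^ (1 / b)) ^ b =
      (t / (1 + t)) * (P + n) ^ b + (1 / (1 + t)) * n ^ b := by
  have hPn : 0 < P + n := by linarith
  have hr : 0 < (n / (P + n)) ^ b := Real.rpow_pos_of_pos (by positivity) b
  have hq : 0 < (P + n) ^ b := Real.rpow_pos_of_pos hPn b
  rw [Real.mul_rpow hPn.le (by positivity), ← Real.rpow_mul (by positivity),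
    one_div_mul_cancel hb0.ne', Real.rpow_one, Real.div_rpow hn.le hPn.le]
  field_simp
  ring

theorem step_ineq (P b n n' t : ℝ) (hP : 0 < P) (hb0 : 0 < b) (hb1 : b < 1) (hn : 0 < n)
    (hnn : n ≤ n') (ht : 0 ≤ t) :
    (n' - n) + (P + n) * (((n / (P + n)) ^ b + t) / (1 + t)) ^ (1 / b) ≤
      (P + n') * (((n' / (P + n')) ^ b + t) / (1 + t)) ^ (1 / b) := by
  have hn' : 0 < n' := by linarith
  have hPn : 0 < P + n := by linarith
  have hPn' : 0 < P + n' := by linarith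
  have hr : 0 < (n / (P + n)) ^ b := Real.rpow_pos_of_pos (by positivity) b
  have hr' : 0 < (n' / (P + n')) ^ b := Real.rpow_pos_of_pos (by positivity) b
  have hA : 0 < (P + n) * (((n / (P + n)) ^ b + t) / (1 + t)) ^ (1 / b) := by positivity
  have hB : 0 < (P + n') * (((n' / (P + n')) ^ b + t) / (1 + t)) ^ (1 / b) := by positivity
  have h := superadd b (t / (1 + t)) (1 / (1 + t)) (P + n) n (n' - n) _ hb0 hb1
    (by positivity) (by positivity) (by field_simp; ring) hPn hn (by linarith) hA
    (mean_pow P b n t hP hb0 hn ht)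
  rw [show P + n + (n' - n) = P + n' by ring, show n + (n' - n) = n' by ring,
    ← mean_pow P b n' t hP hb0 hn' ht] at h
  have := (Real.rpow_le_rpow_iff (by linarith) hB.le hb0).1 h
  linarith

theorem N_pos (K : ℕ) (N : ℕ → ℝ) (hNK : 0 < N K)
    (hNdec : ∀ k, 1 ≤ k → k < K → N (k + 1) < N k) (k : ℕ) (hk : 1 ≤ k) (hkK : k ≤ K) :
    0 < N k := by
  obtain ⟨m, rfl⟩ := Nat.exists_eq_add_of_le hkK
  clear hkK
  induction m generalizing k with
  | zero => simpa using hNK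
  | succ m ih =>
    have := ih (k + 1) (by omega) (by rwa [show k + 1 + m = k + (m + 1) by ring])
      (fun j h1 h2 => hNdec j h1 (by omega))
    have := hNdec k hk (by omega)
    linarith

theorem sufficiency (K : ℕ) (hK : 1 ≤ K) (P b : ℝ)
    (hP : 0 < P) (hb0 : 0 < b) (hb1 : b < 1) (N : ℕ → ℝ) (hNK : 0 < N K)
    (hNdec : ∀ k, 1 ≤ k → k < K → N (k + 1) < N k)
    (D : ℕ → ℝ) (hD : ∀ k, 1 ≤ k → k ≤ K → 0 < D k)
    (h : ∀ k, 1 ≤ k → k ≤ K → (N k / (P + N k)) ^ b ≤ D k)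
    (τ : ℕ → ℝ) (hτ : ∀ k, 0 ≤ τ k) (hτK : τ K = 0)
    (hmono : ∀ k, 1 ≤ k → k < K → τ (k + 1) ≤ τ k) :
    tianF K N b D τ ≤ P + N 1 := by
  have hN := N_pos K N hNK hNdec
  have hT := tianT_pos K D τ hD hτ
  have hE : ∀ k, 1 ≤ k → k ≤ K → 0 < (N k / (P + N k)) ^ b := fun k h1 h2 => by
    have := hN k h1 h2
    exact Real.rpow_pos_of_pos (by positivity) b
  have inv : ∀ m, 1 ≤ m → m ≤ K →
      ∑ k ∈ Ico 1 m, deltaN K N k * tianT D τ k ^ (1 / b) +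
        (P + N m) * (tianT D τ m * (((N m / (P + N m)) ^ b + τ m) / (1 + τ m))) ^ (1 / b)
        ≤ P + N 1 := by
    intro m hm
    induction m, hm using Nat.le_induction with
    | base =>
      intro _
      have h1 := h 1 le_rfl hK
      have h2 := hE 1 le_rfl hK
      have h3 := hτ 1
      have h4 := hD 1 le_rfl hK
      have h5 := hN 1 le_rfl hK
      simp only [Finset.Ico_self, Finset.sum_empty, zero_add, tianT_one]
      have : (1 + τ 1) / (D 1 + τ 1) * (((N 1 / (P + N 1)) ^ b + τ 1) / (1 + τ 1)) ≤ 1 := by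
        rw [div_mul_div_comm, div_le_one (by positivity)]
        nlinarith
      have := Real.rpow_le_one (by positivity) this (z := 1 / b) (by positivity)
      nlinarith
    | succ m hm ih =>
      intro hmK
      refine le_trans ?_ (ih (by omega))
      rw [Finset.sum_Ico_succ_top hm, add_assoc]
      refine add_le_add le_rfl ?_
      have hTm := hT m (by omega)
      have hNm := hN (m + 1) (by omega) hmK
      have hNm' := hN m (by omega) (by omega)
      have hEm := hE (m + 1) (by omega) hmK
      have hEm' := hE m (by omega) (by omega)
      have hDm := hD (m + 1) (by omega) hmK
      have t0 := hτ m
      have t1 := hτ (m + 1)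
      have tm := hmono m hm (by omega)
      have hh := h (m + 1) (by omega) hmK
      have hst := step_ineq P b (N (m + 1)) (N m) (τ m) hP hb0 hb1 hNm
        (hNdec m hm (by omega)).le t0
      have hle : tianT D τ (m + 1) *
          (((N (m + 1) / (P + N (m + 1))) ^ b + τ (m + 1)) / (1 + τ (m + 1))) ≤
          tianT D τ m * (((N (m + 1) / (P + N (m + 1))) ^ b + τ m) / (1 + τ m)) := by
        rw [tianT_succ D τ m hm (by positivity), mul_assoc]
        gcongr
        rw [div_mul_div_comm, div_le_div_iff₀ (by positivity) (by positivity)]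
        have : (D (m + 1) + τ m) * ((N (m + 1) / (P + N (m + 1))) ^ b + τ (m + 1)) ≤
            ((N (m + 1) / (P + N (m + 1))) ^ b + τ m) * (D (m + 1) + τ (m + 1)) := by
          nlinarith [mul_nonneg (sub_nonneg.2 hh) (sub_nonneg.2 tm)]
        have h6 := mul_le_mul_of_nonneg_left this
          (show 0 ≤ (1 + τ (m + 1)) * (1 + τ m) by positivity)
        linarith
      have hTs := hT (m + 1) hmK
      have hle2 := Real.rpow_le_rpow (by positivity) hle (z := 1 / b) (by positivity)
      have hd : deltaN K N m = N m - N (m + 1) := by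
        simp [deltaN, show m ≠ K by omega]
      rw [hd]
      have hle3 := mul_le_mul_of_nonneg_left hle2 (show 0 ≤ P + N (m + 1) by positivity)
      refine le_trans (add_le_add_right hle3 _) ?_
      rw [Real.mul_rpow hTm.le (by positivity), Real.mul_rpow hTm.le (by positivity)]
      have h7 := mul_le_mul_of_nonneg_left hst
        (show 0 ≤ tianT D τ m ^ (1 / b) by positivity)
      linarith
  have hf := inv K hK le_rfl
  have e : tianF K N b D τ = ∑ k ∈ Icc 1 K, deltaN K N k * tianT D τ k ^ (1 / b) := rfl
  rw [e, ← Finset.Ico_add_one_right_eq_Icc, Finset.sum_Ico_succ_top hK]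
  refine le_trans (le_of_eq ?_) hf
  congr 1
  have hTK := hT K le_rfl
  have hEK := hE K hK le_rfl
  rw [hτK, add_zero, add_zero, div_one, Real.mul_rpow hTK.le hEK.le,
    ← Real.rpow_mul (by positivity), mul_one_div_cancel hb0.ne', Real.rpow_one]
  simp only [deltaN, if_true]
  field_simp

/-- The extremal choice of `τ`. -/
noncomputable def tauT (k₀ : ℕ) (t : ℝ) (j : ℕ) : ℝ := if j < k₀ then t else 0

theorem tianT_tau (K k₀ : ℕ) (h1 : 1 ≤ k₀) (D : ℕ → ℝ)
    (hD : ∀ k, 1 ≤ k → k ≤ K → 0 < D k) (hk₀ : k₀ ≤ K) (t : ℝ) (ht : 0 ≤ t) (k : ℕ) (hk : 1 ≤ k) :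
    k ≤ K → tianT D (tauT k₀ t) k =
      if k < k₀ then (1 + t) / (D 1 + t) else (D k₀ + t) / (D 1 + t) * (1 / D k₀) := by
  have hD0 := hD k₀ h1 hk₀
  have hD1 := hD 1 le_rfl (by omega)
  induction k, hk using Nat.le_induction with
  | base =>
    intro _
    rw [tianT_one]
    rcases h1.eq_or_lt with h | h
    · subst h
      simp [tauT]
      field_simp
    · simp [tauT, h]
  | succ k hk ih =>
    intro hkK
    have hDk := hD (k + 1) (by omega) hkK
    have hpos : 0 < 1 + tauT k₀ t k := by
      unfold tauT
      split_ifs <;> linarith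
    rw [tianT_succ _ _ _ hk hpos.ne', ih (by omega)]
    rcases lt_trichotomy (k + 1) k₀ with h | h | h
    · simp only [tauT, h, show k < k₀ by omega, if_true]
      field_simp
    · subst h
      simp [tauT]
      field_simp
    · simp only [tauT, show ¬ (k + 1 < k₀) by omega, show ¬ (k < k₀) by omega, if_false]
      field_simp

theorem telescoping (N : ℕ → ℝ) (k₀ : ℕ) (h1 : 1 ≤ k₀) (c : ℝ) (m : ℕ) :
    ∑ k ∈ Ico 1 (m + 1), (N k - N (k + 1)) * (if k < k₀ then 1 else c) =
      if m < k₀ then N 1 - N (m + 1) else N 1 - N k₀ + (N k₀ - N (m + 1)) * c := by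
  induction m with
  | zero => simp [show 0 < k₀ by omega]
  | succ m ih =>
    rw [Finset.sum_Ico_succ_top (by omega), ih]
    rcases lt_trichotomy (m + 1) k₀ with h | h | h
    · simp only [h, show m < k₀ by omega, if_true]
      ring
    · subst h
      simp
    · simp only [show ¬ (m + 1 < k₀) by omega, show ¬ (m < k₀) by omega, if_false]
      ring

theorem tendsto_ratio (a c : ℝ) :
    Filter.Tendsto (fun t : ℝ => (a + t) / (c + t)) Filter.atTop (nhds 1) := by
  have h : Filter.Tendsto (fun t : ℝ => 1 + (a - c) / (c + t)) Filter.atTop (nhds (1 + 0)) :=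
    tendsto_const_nhds.add
      (Filter.Tendsto.const_div_atTop (Filter.tendsto_atTop_add_const_left _ _ Filter.tendsto_id) _)
  rw [add_zero] at h
  refine h.congr' ?_
  filter_upwards [Filter.eventually_gt_atTop (-c)] with t ht
  have : c + t ≠ 0 := by linarith
  field_simp
  ring

theorem necessity (K : ℕ) (P b : ℝ)
    (hP : 0 < P) (hb0 : 0 < b) (N : ℕ → ℝ) (hNK : 0 < N K)
    (hNdec : ∀ k, 1 ≤ k → k < K → N (k + 1) < N k)
    (D : ℕ → ℝ) (hD : ∀ k, 1 ≤ k → k ≤ K → 0 < D k)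
    (h : ∀ τ : ℕ → ℝ, (∀ k, 0 ≤ τ k) → τ K = 0 →
        (∀ k, 1 ≤ k → k < K → τ (k + 1) ≤ τ k) → tianF K N b D τ ≤ P + N 1)
    (k₀ : ℕ) (h1 : 1 ≤ k₀) (hk₀ : k₀ ≤ K) : (N k₀ / (P + N k₀)) ^ b ≤ D k₀ := by
  have hN0 := N_pos K N hNK hNdec k₀ h1 hk₀
  have hD0 := hD k₀ h1 hk₀
  have hlim : Filter.Tendsto (fun t : ℝ => ∑ k ∈ Icc 1 K, deltaN K N k *
      (if k < k₀ then (1 + t) / (D 1 + t) else (D k₀ + t) / (D 1 + t) * (1 / D k₀)) ^ (1 / b))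
      Filter.atTop (nhds (∑ k ∈ Icc 1 K, deltaN K N k *
        (if k < k₀ then 1 else (1 / D k₀) ^ (1 / b)))) := by
    refine tendsto_finsetSum _ fun k _ => Filter.Tendsto.const_mul _ ?_
    split_ifs
    · have := (tendsto_ratio 1 (D 1)).rpow_const (p := 1 / b) (Or.inl one_ne_zero)
      rwa [Real.one_rpow] at this
    · have := ((tendsto_ratio (D k₀) (D 1)).mul_const (1 / D k₀)).rpow_const (p := 1 / b)
        (Or.inl (by positivity))
      rwa [one_mul] at this
  have hle := le_of_tendsto hlim (b := P + N 1) (by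
    filter_upwards [Filter.eventually_ge_atTop 0] with t ht
    refine le_trans (le_of_eq ?_) (h (tauT k₀ t) ?_ ?_ ?_)
    · refine Finset.sum_congr rfl fun k hk => ?_
      rw [Finset.mem_Icc] at hk
      rw [← tianT_tau K k₀ h1 D hD hk₀ t ht k hk.1 hk.2]
      rfl
    · intro k
      unfold tauT
      split_ifs <;> linarith
    · simp [tauT, show ¬ (K < k₀) by omega]
    · intro k _ _
      unfold tauT
      split_ifs <;> linarith)
  obtain ⟨m, rfl⟩ : ∃ m, K = m + 1 := ⟨K - 1, by omega⟩
  rw [← Finset.Ico_add_one_right_eq_Icc, Finset.sum_Ico_succ_top (by omega)] at hle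
  have e : ∑ k ∈ Ico 1 (m + 1), deltaN (m + 1) N k *
      (if k < k₀ then 1 else (1 / D k₀) ^ (1 / b)) =
      ∑ k ∈ Ico 1 (m + 1), (N k - N (k + 1)) *
        (if k < k₀ then 1 else (1 / D k₀) ^ (1 / b)) := by
    refine Finset.sum_congr rfl fun k hk => ?_
    rw [Finset.mem_Ico] at hk
    simp [deltaN, show k ≠ m + 1 by omega]
  rw [e, telescoping N k₀ h1] at hle
  have e2 : N k₀ * (1 / D k₀) ^ (1 / b) ≤ P + N k₀ := by
    simp only [deltaN, if_true, show ¬ (m + 1 < k₀) by omega, if_false] at hle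
    split_ifs at hle with hm
    · obtain rfl : k₀ = m + 1 := by omega
      linarith
    · linarith
  rw [Real.div_rpow zero_le_one hD0.le, Real.one_rpow] at e2
  have hDp : 0 < D k₀ ^ (1 / b) := Real.rpow_pos_of_pos hD0 _
  have e3 : N k₀ / (P + N k₀) ≤ D k₀ ^ (1 / b) := by
    rw [mul_one_div, div_le_iff₀ hDp] at e2
    rw [div_le_iff₀ (by positivity)]
    linarith
  have e4 := Real.rpow_le_rpow (by positivity) e3 hb0.le
  rwa [← Real.rpow_mul hD0.le, one_div_mul_cancel hb0.ne', Real.rpow_one] at e4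

/-- Corollary 1: for bandwidth compression (`0 < b < 1`), the Tian et al. outer bound
degenerates to the trivial outer bound: `F(D,τ) ≤ P + N₁` holds for every admissible `τ`
iff `D_k ≥ D_k* = (N_k/(P+N_k))^b` for all `1 ≤ k ≤ K`. -/
theorem tian_outer_bound_degenerates_compression (K : ℕ) (hK : 1 ≤ K) (P b : ℝ)
    (hP : 0 < P) (hb0 : 0 < b) (hb1 : b < 1) (N : ℕ → ℝ) (hNK : 0 < N K)
    (hNdec : ∀ k, 1 ≤ k → k < K → N (k + 1) < N k)
    (D : ℕ → ℝ) (hD : ∀ k, 1 ≤ k → k ≤ K → 0 < D k) :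
    (∀ τ : ℕ → ℝ, (∀ k, 0 ≤ τ k) → τ K = 0 →
        (∀ k, 1 ≤ k → k < K → τ (k + 1) ≤ τ k) →
        tianF K N b D τ ≤ P + N 1)
      ↔ ∀ k, 1 ≤ k → k ≤ K → (N k / (P + N k)) ^ b ≤ D k := by
  constructor
  · intro h k h1 h2
    exact necessity K P b hP hb0 N hNK hNdec D hD h k h1 h2
  · intro h τ hτ hτK hmono
    exact sufficiency K hK P b hP hb0 hb1 N hNK hNdec D hD h τ hτ hτK hmono
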